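/- Let K be a field and let 0 = V₀ ⊂ V₁ ⊂ ⋯ ⊂ V_n = Kⁿ be a complete flag (dim Vᵢ = i). For each 1 ≤ i ≤ n the image of the i-th exterior power Λⁱ(Vᵢ) in Λⁱ(Kⁿ) is one-dimensional. Moreover, the assignment sending a tuple (t₁, …, t_n) of K-linear isomorphisms tᵢ : Vᵢ/V_{i−1} ≅ K to the tuple (ω₁, …, ω_n) defined recursively by ω₀ = 1 and ωᵢ = ω_{i−1} ∧ vᵢ, where vᵢ ∈ Vᵢ is any vector with tᵢ(vᵢ + V_{i−1}) = 1, is well defined (ωᵢ does not depend on the choice of representative vᵢ) and is a bijection onto the set of tuples (ω₁, …, ω_n) with ωᵢ a nonzero element of the image of Λⁱ(Vᵢ) in Λⁱ(Kⁿ). -/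

import Mathlib

/-- The image of the `i`-th exterior power `Λⁱ(V)` of a subspace `V ⊆ Kⁿ` inside the
exterior algebra `Λ(Kⁿ)`: the span of `i`-fold wedge products of vectors of `V`. -/
def wedgeImage (K : Type*) [Field K] {n : ℕ} (V : Submodule K (Fin n → K)) (i : ℕ) :
    Submodule K (ExteriorAlgebra K (Fin n → K)) :=
  Submodule.span K
    {x | ∃ v : Fin i → (Fin n → K), (∀ j, v j ∈ V) ∧
      x = (List.ofFn fun j => ExteriorAlgebra.ι K (v j)).prod}

/-- `ω` is the tuple of decorations (volume forms) associated to the tuple `t` of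
trivializations `tᵢ : Vᵢ/V_{i−1} ≅ K`: `ω₀ = 1` and `ωᵢ = ω_{i−1} ∧ vᵢ` for some (hence,
by the theorem below, any) `vᵢ ∈ Vᵢ` with `tᵢ(vᵢ + V_{i−1}) = 1`. -/
def IsDecoration (K : Type*) [Field K] (n : ℕ)
    (V : Fin (n + 1) → Submodule K (Fin n → K))
    (t : ∀ i : Fin n,
      (↥(V i.succ) ⧸ Submodule.comap (V i.succ).subtype (V i.castSucc)) ≃ₗ[K] K)
    (ω : Fin (n + 1) → ExteriorAlgebra K (Fin n → K)) : Prop :=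
  ω 0 = 1 ∧ ∀ i : Fin n, ∃ v : ↥(V i.succ),
    t i (Submodule.Quotient.mk v) = 1 ∧
    ω i.succ = ω i.castSucc * ExteriorAlgebra.ι K (v : Fin n → K)

section WedgeImage

variable {K : Type*} [Field K] {n : ℕ}

lemma wedgeImage_eq_span_ιMulti (V : Submodule K (Fin n → K)) (i : ℕ) :
    wedgeImage K V i = Submodule.span K
      {x | ∃ v : Fin i → (Fin n → K), (∀ j, v j ∈ V) ∧ x = ExteriorAlgebra.ιMulti K i v} := by
  simp only [wedgeImage, ExteriorAlgebra.ιMulti_apply]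

lemma ιMulti_mem_wedgeImage {V : Submodule K (Fin n → K)} {i : ℕ} {v : Fin i → (Fin n → K)}
    (hv : ∀ j, v j ∈ V) : ExteriorAlgebra.ιMulti K i v ∈ wedgeImage K V i := by
  rw [wedgeImage_eq_span_ιMulti]
  exact Submodule.subset_span ⟨v, hv, rfl⟩

lemma one_mem_wedgeImage_zero (V : Submodule K (Fin n → K)) : 1 ∈ wedgeImage K V 0 :=
  Submodule.subset_span ⟨Fin.elim0, fun j => j.elim0, by simp⟩

lemma wedgeImage_eq_range (V : Submodule K (Fin n → K)) (i : ℕ) :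
    wedgeImage K V i = LinearMap.range
      ((⋀[K]^i (Fin n → K)).subtype ∘ₗ exteriorPower.map i V.subtype) := by
  rw [LinearMap.range_eq_map, ← exteriorPower.ιMulti_span, Submodule.map_span, ← Set.range_comp,
    wedgeImage_eq_span_ιMulti]
  congr 1
  ext x
  constructor
  · rintro ⟨v, hv, rfl⟩
    refine ⟨fun j => ⟨v j, hv j⟩, ?_⟩
    simp [exteriorPower.map_apply_ιMulti, Function.comp_def]
  · rintro ⟨v, rfl⟩
    refine ⟨fun j => v j, fun j => (v j).2, ?_⟩
    simp [exteriorPower.map_apply_ιMulti, Function.comp_def]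

lemma finrank_wedgeImage (V : Submodule K (Fin n → K)) (i : ℕ) :
    Module.finrank K (wedgeImage K V i) = (Module.finrank K V).choose i := by
  rw [wedgeImage_eq_range, LinearMap.finrank_range_of_inj, exteriorPower.finrank_eq]
  exact Subtype.val_injective.comp (exteriorPower.map_injective_field V.injective_subtype)

instance finite_wedgeImage (V : Submodule K (Fin n → K)) (i : ℕ) :
    Module.Finite K (wedgeImage K V i) := by
  rw [wedgeImage_eq_range]
  infer_instance

lemma ιMulti_mul_ι {i : ℕ} (v : Fin i → (Fin n → K)) (w : Fin n → K) :
    ExteriorAlgebra.ιMulti K i v * ExteriorAlgebra.ι K w =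
      ExteriorAlgebra.ιMulti K (i + 1) (Fin.snoc v w) := by
  simp only [ExteriorAlgebra.ιMulti_apply, List.ofFn_succ', Fin.snoc_castSucc, Fin.snoc_last,
    List.concat_eq_append, List.prod_append, List.prod_singleton]

lemma mul_ι_mem_wedgeImage {V W : Submodule K (Fin n → K)} (hVW : V ≤ W) {i : ℕ}
    {x : ExteriorAlgebra K (Fin n → K)} (hx : x ∈ wedgeImage K V i) {w : Fin n → K} (hw : w ∈ W) :
    x * ExteriorAlgebra.ι K w ∈ wedgeImage K W (i + 1) := by
  rw [wedgeImage_eq_span_ιMulti] at hx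
  induction hx using Submodule.span_induction with
  | mem x hx =>
    obtain ⟨v, hv, rfl⟩ := hx
    rw [ιMulti_mul_ι]
    refine ιMulti_mem_wedgeImage fun j => ?_
    induction j using Fin.lastCases with
    | last => simpa using hw
    | cast j => simpa using hVW (hv j)
  | zero => simp
  | add x y _ _ hx hy => rw [add_mul]; exact add_mem hx hy
  | smul c x _ hx => rw [smul_mul_assoc]; exact Submodule.smul_mem _ c hx

lemma wedgeImage_eq_bot_of_finrank_lt {V : Submodule K (Fin n → K)} {i : ℕ}
    (h : Module.finrank K V < i) : wedgeImage K V i = ⊥ :=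
  Submodule.finrank_eq_zero.mp <| by rw [finrank_wedgeImage, Nat.choose_eq_zero_of_lt h]

lemma mul_ι_eq_zero {V : Submodule K (Fin n → K)} {i : ℕ} (hV : Module.finrank K V = i)
    {x : ExteriorAlgebra K (Fin n → K)} (hx : x ∈ wedgeImage K V i) {w : Fin n → K} (hw : w ∈ V) :
    x * ExteriorAlgebra.ι K w = 0 := by
  have h := mul_ι_mem_wedgeImage le_rfl hx hw
  rwa [wedgeImage_eq_bot_of_finrank_lt (by lia), Submodule.mem_bot] at h

lemma exists_smul_eq_of_mem_wedgeImage {V : Submodule K (Fin n → K)} {i : ℕ}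
    (hV : Module.finrank K V = i) {x y : ExteriorAlgebra K (Fin n → K)}
    (hx : x ∈ wedgeImage K V i) (hx0 : x ≠ 0) (hy : y ∈ wedgeImage K V i) :
    ∃ c : K, c • x = y := by
  have h1 : Module.finrank K (wedgeImage K V i) = 1 := by simp [finrank_wedgeImage, hV]
  obtain ⟨c, hc⟩ := (finrank_eq_one_iff_of_nonzero' (⟨x, hx⟩ : wedgeImage K V i)
    (by simpa [Subtype.ext_iff] using hx0)).mp h1 ⟨y, hy⟩
  exact ⟨c, congrArg Subtype.val hc⟩

lemma contractRight_list_prod_eq_zero {d : Module.Dual K (Fin n → K)} (l : List (Fin n → K))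
    (hl : ∀ v ∈ l, d v = 0) :
    CliffordAlgebra.contractRight (l.map (ExteriorAlgebra.ι K)).prod d = 0 := by
  induction l using List.reverseRecOn with
  | nil => exact CliffordAlgebra.contractRight_one (Q := (0 : QuadraticForm K (Fin n → K))) d
  | append_singleton l w ih =>
    have h := CliffordAlgebra.contractRight_mul_ι (Q := (0 : QuadraticForm K (Fin n → K)))
      d w (l.map (ExteriorAlgebra.ι K)).prod
    rw [ih fun v hv => hl v (by simp [hv]), hl w (by simp), zero_smul, zero_mul, sub_zero] at h
    simpa using h

lemma contractRight_eq_zero_of_mem_wedgeImage {V : Submodule K (Fin n → K)}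
    {d : Module.Dual K (Fin n → K)} (hd : ∀ v ∈ V, d v = 0) {i : ℕ}
    {x : ExteriorAlgebra K (Fin n → K)} (hx : x ∈ wedgeImage K V i) :
    CliffordAlgebra.contractRight x d = 0 := by
  refine (Submodule.span_le (p := LinearMap.ker (CliffordAlgebra.contractRight.flip d))).mpr ?_ hx
  rintro _ ⟨v, hv, rfl⟩
  have h := contractRight_list_prod_eq_zero (d := d) (List.ofFn v) (by
    simpa [List.mem_ofFn] using fun j => hd _ (hv j))
  rwa [List.map_ofFn] at h

lemma mul_ι_ne_zero {V : Submodule K (Fin n → K)} {i : ℕ}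
    {x : ExteriorAlgebra K (Fin n → K)} (hx : x ∈ wedgeImage K V i) (hx0 : x ≠ 0)
    {w : Fin n → K} (hw : w ∉ V) : x * ExteriorAlgebra.ι K w ≠ 0 := by
  obtain ⟨d, hdw, hdV⟩ := Submodule.exists_le_ker_of_notMem hw
  intro h
  have hc := CliffordAlgebra.contractRight_mul_ι (Q := (0 : QuadraticForm K (Fin n → K))) d w x
  rw [contractRight_eq_zero_of_mem_wedgeImage (fun v hv => hdV hv) hx, zero_mul, sub_zero] at hc
  have h0 : d w • x = 0 := by
    rw [← hc]
    exact (congrArg (fun y => CliffordAlgebra.contractRight y d) h).trans (by simp)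
  exact (smul_ne_zero hdw hx0) h0

end WedgeImage

section Line

variable {K M : Type*} [Field K] [AddCommGroup M] [Module K M]

lemma LinearEquiv.exists_apply_eq_one_of_finrank_eq_one (h : Module.finrank K M = 1) {x : M}
    (hx : x ≠ 0) : ∃ e : M ≃ₗ[K] K, e x = 1 := by
  have : Module.Finite K M := Module.finite_of_finrank_eq_succ h
  obtain ⟨e⟩ := FiniteDimensional.nonempty_linearEquiv_of_finrank_eq
    (h.trans (Module.finrank_self K).symm)
  have hex : e x ≠ 0 := by simpa using hx
  exact ⟨e.trans (LinearEquiv.smulOfNeZero K K (e x)⁻¹ (inv_ne_zero hex)), by simp [hex]⟩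

lemma LinearEquiv.eq_of_apply_eq_one {e f : M ≃ₗ[K] K} {x : M} (he : e x = 1) (hf : f x = 1) :
    e = f := by
  ext y
  have hy : y = e y • x := e.injective (by simp [he])
  rw [hy, map_smul, map_smul, he, hf]

end Line

section Decoration

variable {K : Type*} [Field K] {n : ℕ} {V : Fin (n + 1) → Submodule K (Fin n → K)}

lemma finrank_flag_quotient (hmono : Monotone V)
    (hdim : ∀ i : Fin (n + 1), Module.finrank K (V i) = (i : ℕ)) (i : Fin n) :
    Module.finrank K (↥(V i.succ) ⧸ Submodule.comap (V i.succ).subtype (V i.castSucc)) = 1 := by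
  have h := Submodule.finrank_quotient_add_finrank
    (Submodule.comap (V i.succ).subtype (V i.castSucc))
  have h' := (Submodule.comapSubtypeEquivOfLe (hmono i.castSucc_le_succ)).finrank_eq
  rw [hdim] at h h'
  simp only [Fin.val_succ, Fin.val_castSucc] at h h'
  lia

variable {t : ∀ i : Fin n,
  (↥(V i.succ) ⧸ Submodule.comap (V i.succ).subtype (V i.castSucc)) ≃ₗ[K] K}

lemma notMem_of_trivialization_eq_one {i : Fin n} {v : ↥(V i.succ)}
    (hv : t i (Submodule.Quotient.mk v) = 1) : (v : Fin n → K) ∉ V i.castSucc := by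
  intro h
  have : (Submodule.Quotient.mk v :
      ↥(V i.succ) ⧸ Submodule.comap (V i.succ).subtype (V i.castSucc)) = 0 :=
    (Submodule.Quotient.mk_eq_zero _).mpr h
  simp [this] at hv

lemma exists_trivialization_eq_one (i : Fin n) :
    ∃ v : ↥(V i.succ), t i (Submodule.Quotient.mk v) = 1 := by
  obtain ⟨v, hv⟩ := Submodule.Quotient.mk_surjective _ ((t i).symm 1)
  exact ⟨v, by simp [hv]⟩

lemma exists_isDecoration : ∃ ω, IsDecoration K n V t ω := by
  choose v hv using exists_trivialization_eq_one (t := t)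
  exact ⟨Fin.induction 1 fun i x => x * ExteriorAlgebra.ι K (v i : Fin n → K), rfl,
    fun i => ⟨v i, hv i, Fin.induction_succ ..⟩⟩

variable {ω ω' : Fin (n + 1) → ExteriorAlgebra K (Fin n → K)}

lemma IsDecoration.mem_wedgeImage_and_ne_zero (hmono : Monotone V) (h : IsDecoration K n V t ω)
    (i : Fin (n + 1)) : ω i ∈ wedgeImage K (V i) (i : ℕ) ∧ ω i ≠ 0 := by
  induction i using Fin.induction with
  | zero => rw [h.1]; exact ⟨one_mem_wedgeImage_zero _, one_ne_zero⟩
  | succ i ih =>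
    obtain ⟨v, hv, hω⟩ := h.2 i
    rw [hω]
    exact ⟨mul_ι_mem_wedgeImage (hmono i.castSucc_le_succ) ih.1 v.2,
      mul_ι_ne_zero ih.1 ih.2 (notMem_of_trivialization_eq_one hv)⟩

lemma IsDecoration.unique (hmono : Monotone V)
    (hdim : ∀ i : Fin (n + 1), Module.finrank K (V i) = (i : ℕ))
    (h : IsDecoration K n V t ω) (h' : IsDecoration K n V t ω') : ω = ω' := by
  ext1 i
  induction i using Fin.induction with
  | zero => rw [h.1, h'.1]
  | succ i ih =>
    obtain ⟨v, hv, hω⟩ := h.2 i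
    obtain ⟨v', hv', hω'⟩ := h'.2 i
    have hsub : (v : Fin n → K) - v' ∈ V i.castSucc :=
      (Submodule.Quotient.eq (Submodule.comap (V i.succ).subtype (V i.castSucc))).mp
        ((t i).injective (hv.trans hv'.symm))
    have := mul_ι_eq_zero (hdim _) (h.mem_wedgeImage_and_ne_zero hmono i.castSucc).1 hsub
    rw [map_sub, mul_sub, sub_eq_zero] at this
    rw [hω, hω', ← ih, this]

lemma IsDecoration.trivialization_unique (hmono : Monotone V)
    {t' : ∀ i : Fin n,
      (↥(V i.succ) ⧸ Submodule.comap (V i.succ).subtype (V i.castSucc)) ≃ₗ[K] K}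
    (h : IsDecoration K n V t ω) (h' : IsDecoration K n V t' ω) : t = t' := by
  ext1 i
  obtain ⟨v, hv, hω⟩ := h.2 i
  obtain ⟨v', hv', hω'⟩ := h'.2 i
  obtain ⟨hmem, hne⟩ := h.mem_wedgeImage_and_ne_zero hmono i.castSucc
  have hsub : (v : Fin n → K) - v' ∈ V i.castSucc := by
    by_contra hnot
    exact mul_ι_ne_zero hmem hne hnot (by rw [map_sub, mul_sub, ← hω, ← hω', sub_self])
  refine LinearEquiv.eq_of_apply_eq_one hv ?_
  have hmk : (Submodule.Quotient.mk v :
      ↥(V i.succ) ⧸ Submodule.comap (V i.succ).subtype (V i.castSucc)) =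
      Submodule.Quotient.mk v' := (Submodule.Quotient.eq _).mpr hsub
  rwa [hmk]

lemma exists_trivialization_isDecoration (hmono : Monotone V)
    (hdim : ∀ i : Fin (n + 1), Module.finrank K (V i) = (i : ℕ)) (h0 : ω 0 = 1)
    (hω : ∀ i : Fin (n + 1), 1 ≤ (i : ℕ) → ω i ∈ wedgeImage K (V i) (i : ℕ) ∧ ω i ≠ 0) :
    ∃ t, IsDecoration K n V t ω := by
  have hω' (i : Fin (n + 1)) : ω i ∈ wedgeImage K (V i) (i : ℕ) ∧ ω i ≠ 0 := by
    rcases Fin.eq_zero_or_eq_succ i with rfl | ⟨j, rfl⟩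
    · rw [h0]; exact ⟨one_mem_wedgeImage_zero _, one_ne_zero⟩
    · exact hω _ (by simp)
  have key (i : Fin n) :
      ∃ e : (↥(V i.succ) ⧸ Submodule.comap (V i.succ).subtype (V i.castSucc)) ≃ₗ[K] K,
      ∃ v : ↥(V i.succ), e (Submodule.Quotient.mk v) = 1 ∧
        ω i.succ = ω i.castSucc * ExteriorAlgebra.ι K (v : Fin n → K) := by
    have hlt : ¬ V i.succ ≤ V i.castSucc := fun hle => by
      have := Submodule.finrank_mono hle
      simp [hdim] at this
    obtain ⟨u, hu, hu'⟩ := SetLike.not_le_iff_exists.mp hlt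
    obtain ⟨hmem, hne⟩ := hω' i.castSucc
    obtain ⟨c, hc⟩ := exists_smul_eq_of_mem_wedgeImage (hdim i.succ)
      (mul_ι_mem_wedgeImage (hmono i.castSucc_le_succ) hmem hu) (mul_ι_ne_zero hmem hne hu')
      (hω' i.succ).1
    have hc0 : c ≠ 0 := by
      rintro rfl
      exact (hω' i.succ).2 (by rw [← hc, zero_smul])
    have hv : (Submodule.Quotient.mk (c • ⟨u, hu⟩) :
        ↥(V i.succ) ⧸ Submodule.comap (V i.succ).subtype (V i.castSucc)) ≠ 0 := by
      rw [Ne, Submodule.Quotient.mk_eq_zero, Submodule.smul_mem_iff _ hc0]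
      exact hu'
    obtain ⟨e, he⟩ :=
      LinearEquiv.exists_apply_eq_one_of_finrank_eq_one (finrank_flag_quotient hmono hdim i) hv
    exact ⟨e, c • ⟨u, hu⟩, he, by rw [← hc]; simp⟩
  choose t ht using key
  exact ⟨t, h0, ht⟩

end Decoration

/-- For a complete flag `0 = V₀ ⊂ V₁ ⊂ ⋯ ⊂ V_n = Kⁿ` (`dim Vᵢ = i`): the image of
`Λⁱ(Vᵢ)` in `Λⁱ(Kⁿ)` is one-dimensional; the decoration tuple `(ω₁, …, ω_n)` associated
to a tuple of trivializations `tᵢ : Vᵢ/V_{i−1} ≅ K` is well defined (independent of the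
choice of representatives `vᵢ`); and the resulting assignment is a bijection onto the set
of tuples `(ω₁, …, ω_n)` with each `ωᵢ` a nonzero element of the image of `Λⁱ(Vᵢ)`. -/
theorem stmt_11 (K : Type*) [Field K] (n : ℕ)
    (V : Fin (n + 1) → Submodule K (Fin n → K))
    (hmono : Monotone V)
    (hdim : ∀ i : Fin (n + 1), Module.finrank K (V i) = (i : ℕ)) :
    (∀ i : Fin (n + 1), 1 ≤ (i : ℕ) →
      Module.finrank K (wedgeImage K (V i) (i : ℕ)) = 1) ∧
    (∀ t : ∀ i : Fin n,
        (↥(V i.succ) ⧸ Submodule.comap (V i.succ).subtype (V i.castSucc)) ≃ₗ[K] K,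
      ∃! ω : Fin (n + 1) → ExteriorAlgebra K (Fin n → K), IsDecoration K n V t ω) ∧
    (∃ F : (∀ i : Fin n,
        (↥(V i.succ) ⧸ Submodule.comap (V i.succ).subtype (V i.castSucc)) ≃ₗ[K] K) →
        (Fin (n + 1) → ExteriorAlgebra K (Fin n → K)),
      (∀ t, IsDecoration K n V t (F t)) ∧
      Set.BijOn F Set.univ
        {ω : Fin (n + 1) → ExteriorAlgebra K (Fin n → K) |
          ω 0 = 1 ∧ ∀ i : Fin (n + 1), 1 ≤ (i : ℕ) →
            ω i ∈ wedgeImage K (V i) (i : ℕ) ∧ ω i ≠ 0}) := by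
  refine ⟨fun i _ => by rw [finrank_wedgeImage, hdim, Nat.choose_self], fun t => ?_, ?_⟩
  · obtain ⟨ω, hω⟩ := exists_isDecoration (t := t)
    exact ⟨ω, hω, fun ω' hω' => hω'.unique hmono hdim hω⟩
  · choose F hF using fun t => exists_isDecoration (V := V) (t := t)
    refine ⟨F, hF, fun t _ => ⟨(hF t).1, fun i _ => (hF t).mem_wedgeImage_and_ne_zero hmono i⟩,
      fun t _ t' _ h => (hF t).trivialization_unique hmono (h ▸ hF t'), ?_⟩
    rintro ω ⟨h0, hω⟩
    obtain ⟨t, ht⟩ := exists_trivialization_isDecoration hmono hdim h0 hω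
    exact ⟨t, Set.mem_univ t, (hF t).unique hmono hdim ht⟩
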